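/- For every real number x, the function t ↦ log|2 sin t| is interval-integrable on [0,x] (so the Lobachevsky function Λ(x) = −∫₀ˣ log|2 sin t| dt is well-defined for all real x), and the function Λ : ℝ → ℝ is continuous. -/

import Mathlib

open Real

/-- The Lobachevsky function `Λ(x) = -∫₀ˣ log |2 sin t| dt`. -/
noncomputable def lob (x : ℝ) : ℝ := -∫ t in (0:ℝ)..x, Real.log |2 * Real.sin t|

theorem intervalIntegrable_log_abs_two_mul_sin (a b : ℝ) :
    IntervalIntegrable (fun t : ℝ => Real.log |2 * Real.sin t|) MeasureTheory.volume a b := by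
  have h : MeromorphicOn (fun t : ℝ => 2 * Real.sin t) (Set.uIcc a b) :=
    (analyticOnNhd_const.mul Real.analyticOnNhd_sin).meromorphicOn
  exact h.intervalIntegrable_log_norm

/-- The integrand `log |2 sin t|` is interval-integrable on `[0,x]` for every real `x`
(so the Lobachevsky function is well-defined), and `Λ` is continuous on `ℝ`. -/
theorem lob_well_defined_and_continuous :
    (∀ x : ℝ, IntervalIntegrable (fun t : ℝ => Real.log |2 * Real.sin t|)
      MeasureTheory.volume 0 x) ∧ Continuous lob := by
  exact ⟨intervalIntegrable_log_abs_two_mul_sin 0,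
    (intervalIntegral.continuous_primitive intervalIntegrable_log_abs_two_mul_sin 0).neg⟩
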